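/- arXiv:2008.06077 — 3 statements merged into one kernel-verified Lean document; each statement's English description precedes it below -/
import Mathlib

section
/- Let q₁, q₂ > 1 be integers. Every element of the commutator subgroup [Γ(q₁q₂), Γ(q₁q₂)] lies in K¹_{q₁,q₂}, and moreover there exists an element of K¹_{q₁,q₂} that does not lie in [Γ(q₁q₂), Γ(q₁q₂)]; that is, [Γ(q₁q₂), Γ(q₁q₂)] ⊊ K¹_{q₁,q₂}. -/
open scoped MatrixGroups
open CongruenceSubgroup Matrix

/-- The first Bernoulli function `B₁(x)`: equal to `x - ⌊x⌋ - 1/2` for non-integral `x`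
and `0` for integral `x`. -/
noncomputable def B1 (x : ℝ) : ℝ := if Int.fract x = 0 then 0 else Int.fract x - 1/2

/-- The newform Dedekind sum `S_{χ₁,χ₂}(a, c)`. -/
noncomputable def ded {q₁ q₂ : ℕ} (χ₁ : DirichletCharacter ℂ q₁)
    (χ₂ : DirichletCharacter ℂ q₂) (a c : ℤ) : ℂ :=
  ∑ j ∈ Finset.range c.toNat, ∑ n ∈ Finset.range q₁,
    (starRingEnd ℂ) (χ₂ (j : ZMod q₂)) * (starRingEnd ℂ) (χ₁ (n : ZMod q₁)) *
      ((B1 ((j : ℝ) / (c : ℝ)) * B1 ((n : ℝ) / (q₁ : ℝ) + (a : ℝ) * (j : ℝ) / (c : ℝ)) : ℝ) : ℂ)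

/-- The newform Dedekind sum `S_{χ₁,χ₂}(γ)` of a matrix `γ`. -/
noncomputable def dedSL {q₁ q₂ : ℕ} (χ₁ : DirichletCharacter ℂ q₁)
    (χ₂ : DirichletCharacter ℂ q₂) (γ : SL(2, ℤ)) : ℂ :=
  if 0 < (γ : Matrix (Fin 2) (Fin 2) ℤ) 1 0 then
    ded χ₁ χ₂ ((γ : Matrix (Fin 2) (Fin 2) ℤ) 0 0) ((γ : Matrix (Fin 2) (Fin 2) ℤ) 1 0)
  else if (γ : Matrix (Fin 2) (Fin 2) ℤ) 1 0 < 0 then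
    ded χ₁ χ₂ (-(γ : Matrix (Fin 2) (Fin 2) ℤ) 0 0) (-(γ : Matrix (Fin 2) (Fin 2) ℤ) 1 0)
  else 0

noncomputable def psi2 (x : ℝ) : ℝ := Int.fract x ^ 2 - Int.fract x + 1/6

lemma B1_add_int (x : ℝ) (n : ℤ) : B1 (x + n) = B1 x := by
  unfold B1; rw [Int.fract_add_intCast]

lemma psi2_add_int (x : ℝ) (n : ℤ) : psi2 (x + n) = psi2 x := by
  unfold psi2; rw [Int.fract_add_intCast]

lemma fract_neg_cases (x : ℝ) : (Int.fract x = 0 ∧ Int.fract (-x) = 0) ∨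
    (Int.fract x ≠ 0 ∧ Int.fract (-x) ≠ 0 ∧ Int.fract (-x) = 1 - Int.fract x) := by
  by_cases h : Int.fract x = 0
  · left; exact ⟨h, Int.fract_neg_eq_zero.mpr h⟩
  · right; exact ⟨h, fun h' => h (Int.fract_neg_eq_zero.mp h'), Int.fract_neg h⟩

lemma B1_neg (x : ℝ) : B1 (-x) = - B1 x := by
  unfold B1
  rcases fract_neg_cases x with ⟨h, h'⟩ | ⟨h, h', h''⟩
  · simp [h, h']
  · rw [if_neg h, if_neg h', h'']; ring

lemma psi2_neg (x : ℝ) : psi2 (-x) = psi2 x := by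
  unfold psi2
  rcases fract_neg_cases x with ⟨h, h'⟩ | ⟨h, h', h''⟩
  · simp [h, h']
  · rw [h'']; ring

lemma triple (α β : ℝ) (h : ¬(Int.fract α = 0 ∧ Int.fract β = 0)) :
    (B1 α + B1 β) * B1 (α + β) =
      B1 α * B1 β + 1/2 * (psi2 α + psi2 β + psi2 (α + β)) := by
  have ha0 := Int.fract_nonneg α
  have hb0 := Int.fract_nonneg β
  have ha1 := Int.fract_lt_one α
  have hb1 := Int.fract_lt_one β
  have key : (Int.fract α + Int.fract β < 1 ∧ Int.fract (α + β) = Int.fract α + Int.fract β) ∨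
      (1 ≤ Int.fract α + Int.fract β ∧ Int.fract (α + β) = Int.fract α + Int.fract β - 1) := by
    rcases lt_or_ge (Int.fract α + Int.fract β) 1 with h1 | h1
    · left; refine ⟨h1, ?_⟩
      rw [Int.fract_eq_iff]
      refine ⟨by linarith, h1, ⌊α⌋ + ⌊β⌋, ?_⟩
      simp only [Int.fract]; push_cast; ring
    · right; refine ⟨h1, ?_⟩
      rw [Int.fract_eq_iff]
      refine ⟨by linarith, by linarith, ⌊α⌋ + ⌊β⌋ + 1, ?_⟩
      simp only [Int.fract]; push_cast; ring
  unfold B1 psi2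
  generalize Int.fract (α + β) = w at *
  generalize Int.fract α = u at *
  generalize Int.fract β = v at *
  rcases key with ⟨h1, rfl⟩ | ⟨h1, rfl⟩
  · by_cases hu : u = 0
    · subst hu
      have hv : v ≠ 0 := fun hv => h ⟨rfl, hv⟩
      simp [hv]; ring
    · by_cases hv : v = 0
      · subst hv; simp [hu]; ring
      · have : u + v ≠ 0 := by
          intro h2
          have : u = 0 := by linarith
          exact hu this
        rw [if_neg hu, if_neg hv, if_neg this]; ring
  · have hu : u ≠ 0 := by intro hu; linarith
    have hv : v ≠ 0 := by intro hu; linarith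
    rw [if_neg hu, if_neg hv]
    split_ifs with h2
    · have : v = 1 - u := by linarith
      subst this; ring
    · ring

lemma sum_range_zmod (k : ℕ) [NeZero k] (g : ZMod k → ℝ) :
    ∑ i ∈ Finset.range k, g (i : ZMod k) = ∑ z : ZMod k, g z := by
  refine Finset.sum_bij' (fun i _ => (i : ZMod k)) (fun z _ => z.val) ?_ ?_ ?_ ?_ ?_
  · simp
  · intro z _; simp [ZMod.val_lt]
  · intro i hi; exact ZMod.val_cast_of_lt (Finset.mem_range.mp hi)
  · intro z _; simp
  · simp

lemma sum_affine (k : ℕ) (hk : 0 < k) (f : ℤ → ℝ) (hf : ∀ n, f (n + k) = f n) (h t : ℤ)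
    (hh : IsCoprime h (k : ℤ)) :
    ∑ i ∈ Finset.range k, f (h * i + t) = ∑ i ∈ Finset.range k, f i := by
  have : NeZero k := ⟨hk.ne'⟩
  have hg : ∀ n : ℤ, f n = (fun z : ZMod k => f (z.val : ℤ)) (n : ZMod k) := by
    intro n
    have h1 : ((((n : ZMod k)).val : ℕ) : ℤ) = n % k := ZMod.val_intCast n
    simp only [h1]
    have hp : Function.Periodic f (k : ℤ) := hf
    have := (hp.int_mul (n / k)) (n % k)
    rw [← this]
    congr 1
    have := Int.emod_add_mul_ediv n k
    push_cast; linarith [mul_comm (n / (k:ℤ)) k]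
  set g : ZMod k → ℝ := fun z => f (z.val : ℤ) with hgdef
  have hu : IsUnit ((h : ℤ) : ZMod k) := by
    obtain ⟨a, b, hab⟩ := hh
    have : ((a * h + b * k : ℤ) : ZMod k) = 1 := by rw [hab]; simp
    push_cast at this
    simp at this
    exact IsUnit.of_mul_eq_one_right _ this
  obtain ⟨u, hu⟩ := hu
  have e1 : ∑ i ∈ Finset.range k, f (h * i + t) = ∑ z : ZMod k, g ((u : ZMod k) * z + t) := by
    rw [← sum_range_zmod k (fun z => g ((u : ZMod k) * z + t))]
    refine Finset.sum_congr rfl fun i _ => ?_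
    rw [hg]; push_cast; rw [hu]
  have e2 : ∑ i ∈ Finset.range k, f i = ∑ z : ZMod k, g z := by
    rw [← sum_range_zmod k g]
    refine Finset.sum_congr rfl fun i _ => ?_
    rw [hg]; push_cast; rfl
  rw [e1, e2]
  exact Fintype.sum_equiv ((Units.mulLeft u).trans (Equiv.addRight (t : ZMod k))) _ _ (fun z => by simp)

lemma sum_shift (k : ℕ) (hk : 0 < k) (F : ℝ → ℝ) (hF : ∀ x (n : ℤ), F (x + n) = F x) (y : ℝ) :
    ∑ m ∈ Finset.range k, F ((m + y) / k) = ∑ m ∈ Finset.range k, F ((m + Int.fract y) / k) := by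
  have hk' : (k : ℝ) ≠ 0 := by positivity
  have := sum_affine k hk (fun m => F (((m : ℝ) + Int.fract y) / k)) (by
    intro n; push_cast
    rw [← hF (((n : ℝ) + Int.fract y) / k) 1]
    congr 1; push_cast; field_simp; ring) 1 ⌊y⌋ isCoprime_one_left
  push_cast at this
  rw [← this]
  refine Finset.sum_congr rfl fun m _ => ?_
  congr 2
  nth_rw 1 [← Int.floor_add_fract y]; ring

lemma fract_div (k m : ℕ) (hm : m < k) (y : ℝ) :
    Int.fract ((m + Int.fract y) / k) = (m + Int.fract y) / k := by
  have hk : (0 : ℝ) < k := by exact_mod_cast (Nat.zero_le m).trans_lt hm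
  rw [Int.fract_eq_self]
  have := Int.fract_nonneg y
  have h1 := Int.fract_lt_one y
  have h2 : (m : ℝ) + 1 ≤ k := by exact_mod_cast hm
  exact ⟨by positivity, by rw [div_lt_one hk]; linarith⟩

lemma sum_id (k : ℕ) : ∑ m ∈ Finset.range k, (m : ℝ) = k * (k - 1) / 2 := by
  induction k with
  | zero => simp
  | succ n ih => rw [Finset.sum_range_succ, ih]; push_cast; ring

lemma sum_sq (k : ℕ) : ∑ m ∈ Finset.range k, (m : ℝ)^2 = k * (k - 1) * (2 * k - 1) / 6 := by
  induction k with
  | zero => simp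
  | succ n ih => rw [Finset.sum_range_succ, ih]; push_cast; ring

lemma psi2_dist (k : ℕ) (hk : 0 < k) (y : ℝ) :
    ∑ m ∈ Finset.range k, psi2 ((m + y) / k) = 1 / k * psi2 y := by
  have hk' : (k : ℝ) ≠ 0 := by positivity
  rw [sum_shift k hk psi2 psi2_add_int y]
  have : ∀ m ∈ Finset.range k, psi2 ((m + Int.fract y) / k) =
      (1/k^2) * (m:ℝ)^2 + (2 * Int.fract y / k^2 - 1/k) * m
        + ((Int.fract y)^2/k^2 - Int.fract y / k + 1/6) := by
    intro m hm
    unfold psi2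
    rw [fract_div k m (Finset.mem_range.mp hm)]
    field_simp; ring
  rw [Finset.sum_congr rfl this, Finset.sum_add_distrib, Finset.sum_add_distrib,
    ← Finset.mul_sum, ← Finset.mul_sum, sum_id, sum_sq]
  simp only [Finset.sum_const, Finset.card_range, nsmul_eq_mul]
  unfold psi2
  field_simp; ring

lemma B1_dist (k : ℕ) (hk : 0 < k) (y : ℝ) :
    ∑ m ∈ Finset.range k, B1 ((m + y) / k) = B1 y := by
  have hk' : (k : ℝ) ≠ 0 := by positivity
  rw [sum_shift k hk B1 B1_add_int y]
  have h1 : ∑ m ∈ Finset.range k, ((1/k:ℝ) * m + (Int.fract y / k - 1/2)) = Int.fract y - 1/2 := by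
    rw [Finset.sum_add_distrib, ← Finset.mul_sum, sum_id]
    simp only [Finset.sum_const, Finset.card_range, nsmul_eq_mul]
    field_simp; ring
  by_cases hy : Int.fract y = 0
  · have : ∀ m ∈ Finset.range k, B1 ((m + Int.fract y) / k) =
        ((1/k:ℝ) * m + (Int.fract y / k - 1/2)) + (if m = 0 then 1/2 else 0) := by
      intro m hm
      unfold B1
      rw [fract_div k m (Finset.mem_range.mp hm), hy]
      by_cases hm0 : m = 0
      · simp [hm0]
      · simp [hm0, hk.ne']; field_simp; ring
    rw [Finset.sum_congr rfl this, Finset.sum_add_distrib, h1]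
    unfold B1
    simp [hy, hk]
  · have : ∀ m ∈ Finset.range k, B1 ((m + Int.fract y) / k) =
        ((1/k:ℝ) * m + (Int.fract y / k - 1/2)) := by
      intro m hm
      unfold B1
      rw [fract_div k m (Finset.mem_range.mp hm), if_neg]
      · field_simp; ring
      · have := (Int.fract_nonneg y).lt_of_ne' hy
        positivity
    rw [Finset.sum_congr rfl this, h1]
    unfold B1; rw [if_neg hy]

noncomputable def sN (a : ℤ) (k : ℕ) (x y : ℝ) : ℝ :=
  ∑ m ∈ Finset.range k, B1 ((m + x) / k) * B1 (a * (m + x) / k + y)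

lemma fract_ne_of_div (k : ℕ) (hk : 0 < k) (m : ℕ) (x : ℝ) (h : Int.fract ((m + x) / k) = 0) :
    Int.fract x = 0 := by
  have hk' : (k : ℝ) ≠ 0 := by positivity
  rw [Int.fract_eq_zero_iff] at *
  obtain ⟨z, hz⟩ := h
  refine ⟨k * z - m, ?_⟩
  push_cast; rw [hz]; field_simp; ring

lemma recip (h k : ℕ) (hh : 0 < h) (hk : 0 < k) (hc : IsCoprime (h : ℤ) k) (x y : ℝ)
    (hxy : ¬ (Int.fract x = 0 ∧ Int.fract y = 0)) :
    sN h k y x + sN k h x y = B1 x * B1 y +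
      1/2 * (h/k * psi2 y + k/h * psi2 x + 1/(h*k) * psi2 (h*y+k*x)) := by
  have hk' : (k : ℝ) ≠ 0 := by positivity
  have hh' : (h : ℝ) ≠ 0 := by positivity
  have e1 : sN h k y x = ∑ μ ∈ Finset.range k, ∑ ν ∈ Finset.range h,
      B1 ((μ + y) / k) * B1 ((μ + y) / k + (ν + x) / h) := by
    unfold sN
    refine Finset.sum_congr rfl fun μ _ => ?_
    rw [← Finset.mul_sum, ← B1_dist h hh ((h : ℤ) * (μ + y) / k + x)]
    congr 1
    refine Finset.sum_congr rfl fun ν _ => ?_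
    congr 1; push_cast; field_simp; ring
  have e2 : sN k h x y = ∑ μ ∈ Finset.range k, ∑ ν ∈ Finset.range h,
      B1 ((ν + x) / h) * B1 ((μ + y) / k + (ν + x) / h) := by
    rw [Finset.sum_comm]
    unfold sN
    refine Finset.sum_congr rfl fun ν _ => ?_
    rw [← Finset.mul_sum, ← B1_dist k hk ((k : ℤ) * (ν + x) / h + y)]
    congr 1
    refine Finset.sum_congr rfl fun ν _ => ?_
    congr 1; push_cast; field_simp; ring
  have e3 : ∑ μ ∈ Finset.range k, ∑ ν ∈ Finset.range h, psi2 ((μ + y) / k + (ν + x) / h)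
      = 1/(h*k) * psi2 (h*y+k*x) := by
    have : ∀ μ ∈ Finset.range k, ∑ ν ∈ Finset.range h, psi2 ((μ + y) / k + (ν + x) / h)
        = 1/h * psi2 (((h * μ + 0 : ℤ) + (h*y+k*x)) / k) := by
      intro μ _
      have e : (((h * μ + 0 : ℤ) + (h*y+k*x)) / k : ℝ) = h * (μ + y) / k + x := by
        push_cast; field_simp; ring
      rw [e, ← psi2_dist h hh]
      refine Finset.sum_congr rfl fun ν _ => ?_
      congr 1; field_simp; ring
    rw [Finset.sum_congr rfl this, ← Finset.mul_sum,
      sum_affine k hk (fun m => psi2 (((m : ℝ) + (h*y+k*x)) / k)) (by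
        intro n; push_cast
        rw [← psi2_add_int (((n : ℝ) + _) / k) 1]
        congr 1; push_cast; field_simp; ring) h 0 hc]
    push_cast
    rw [psi2_dist k hk]; field_simp
  have e4 : ∑ μ ∈ Finset.range k, ∑ ν ∈ Finset.range h, B1 ((μ + y) / k) * B1 ((ν + x) / h)
      = B1 x * B1 y := by
    rw [← Finset.sum_mul_sum, B1_dist k hk, B1_dist h hh, mul_comm]
  have e5 : ∑ μ ∈ Finset.range k, ∑ ν ∈ Finset.range h, psi2 ((μ + y) / k) = h/k * psi2 y := by
    simp only [Finset.sum_const, Finset.card_range, nsmul_eq_mul]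
    rw [← Finset.mul_sum, psi2_dist k hk]; ring
  have e6 : ∑ μ ∈ Finset.range k, ∑ ν ∈ Finset.range h, psi2 ((ν + x) / h) = k/h * psi2 x := by
    simp only [Finset.sum_const, Finset.card_range, nsmul_eq_mul]
    rw [psi2_dist h hh]; ring
  rw [← e3, ← e4, ← e5, ← e6, e1, e2]
  simp only [← Finset.sum_add_distrib, Finset.mul_sum]
  refine Finset.sum_congr rfl fun μ _ => Finset.sum_congr rfl fun ν _ => ?_
  rw [← add_mul, triple]
  rintro ⟨h1, h2⟩
  exact hxy ⟨fract_ne_of_div h hh ν x h2, fract_ne_of_div k hk μ y h1⟩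

lemma sN_add_int (a : ℤ) (k : ℕ) (hk : 0 < k) (x y : ℝ) (n m : ℤ) :
    sN a k (x + n) (y + m) = sN a k x y := by
  have hk' : (k : ℝ) ≠ 0 := by positivity
  have := sum_affine k hk (fun i => B1 (((i:ℝ) + x) / k) * B1 (a * (i + x) / k + y)) (by
    intro i; push_cast
    rw [← B1_add_int (((i:ℝ) + x) / k) 1, ← B1_add_int (a * (i + x) / k + y) a]
    congr 2
    · push_cast; field_simp; ring
    · field_simp; ring) 1 n isCoprime_one_left
  push_cast at this
  unfold sN
  rw [← this]
  refine Finset.sum_congr rfl fun i _ => ?_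
  rw [← B1_add_int (a * (1 * i + n + x) / k + y) m]
  congr 2
  · ring
  · ring

lemma sN_neg (a : ℤ) (k : ℕ) (hk : 0 < k) (x y : ℝ) : sN a k (-x) (-y) = sN a k x y := by
  have hk' : (k : ℝ) ≠ 0 := by positivity
  have := sum_affine k hk (fun i => B1 (((i:ℝ) + x) / k) * B1 (a * (i + x) / k + y)) (by
    intro i; push_cast
    rw [← B1_add_int (((i:ℝ) + x) / k) 1, ← B1_add_int (a * (i + x) / k + y) a]
    congr 2
    · push_cast; field_simp; ring
    · field_simp; ring) (-1) 0 isCoprime_one_left.neg_left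
  push_cast at this
  unfold sN
  rw [← this]
  refine Finset.sum_congr rfl fun i _ => ?_
  rw [← neg_mul_neg, ← B1_neg, ← B1_neg]
  congr 2
  · ring
  · ring

lemma sN_neg' (a : ℤ) (k : ℕ) (x y : ℝ) : sN (-a) k x (-y) = - sN a k x y := by
  unfold sN
  rw [← Finset.sum_neg_distrib]
  refine Finset.sum_congr rfl fun i _ => ?_
  rw [← mul_neg, ← B1_neg]
  congr 2
  push_cast; ring

noncomputable def GE (a : ℤ) (k : ℕ) (d : ℤ) (x y : ℝ) : ℝ :=
  a / (2 * k) * psi2 x + d / (2 * k) * psi2 (x * a + y * k) - sN a k x y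

noncomputable def FE (g : SL(2, ℤ)) (x y : ℝ) : ℝ :=
  if 0 < g 1 0 then GE (g 0 0) (g 1 0).toNat (g 1 1) x y
  else if g 1 0 < 0 then GE (-g 0 0) (-g 1 0).toNat (-g 1 1) x y
  else g 0 1 * g 1 1 / 2 * psi2 x

lemma GE_neg (a : ℤ) (k : ℕ) (hk : 0 < k) (d : ℤ) (x y : ℝ) :
    GE a k d (-x) (-y) = GE a k d x y := by
  unfold GE
  rw [sN_neg a k hk, psi2_neg, ← psi2_neg (x * a + y * k)]
  congr 4; ring

lemma GE_add_int (a : ℤ) (k : ℕ) (hk : 0 < k) (d : ℤ) (x y : ℝ) (n m : ℤ) :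
    GE a k d (x + n) (y + m) = GE a k d x y := by
  unfold GE
  rw [sN_add_int a k hk, psi2_add_int, ← psi2_add_int (x * a + y * k) (n * a + m * k)]
  congr 4; push_cast; ring

lemma FE_neg_vec (g : SL(2, ℤ)) (x y : ℝ) : FE g (-x) (-y) = FE g x y := by
  unfold FE
  split_ifs with h1 h2
  · rw [GE_neg]; omega
  · rw [GE_neg]; omega
  · rw [psi2_neg]

lemma FE_add_int (g : SL(2, ℤ)) (x y : ℝ) (n m : ℤ) : FE g (x + n) (y + m) = FE g x y := by
  unfold FE
  split_ifs with h1 h2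
  · rw [GE_add_int]; omega
  · rw [GE_add_int]; omega
  · rw [psi2_add_int]

lemma FE_neg (g : SL(2, ℤ)) (x y : ℝ) : FE (-g) x y = FE g x y := by
  unfold FE
  simp only [SpecialLinearGroup.coe_neg, Matrix.neg_apply, neg_neg]
  rcases lt_trichotomy (g 1 0) 0 with h | h | h
  · rw [if_pos (by omega), if_neg (by omega), if_pos h]
  · simp [h]
  · rw [if_neg (by omega), if_pos (by omega), if_pos h]

lemma det_eq (g : SL(2, ℤ)) : g 0 0 * g 1 1 - g 0 1 * g 1 0 = 1 := by
  have := g.det_coe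
  rwa [Matrix.det_fin_two] at this

open ModularGroup in
lemma T_entries (g : SL(2, ℤ)) : (T * g) 0 0 = g 0 0 + g 1 0 ∧ (T * g) 0 1 = g 0 1 + g 1 1 ∧
    (T * g) 1 0 = g 1 0 ∧ (T * g) 1 1 = g 1 1 := by
  simp [coe_T, Matrix.mul_apply, Fin.sum_univ_two]

open ModularGroup in
lemma S_entries (g : SL(2, ℤ)) : (S * g) 0 0 = - g 1 0 ∧ (S * g) 0 1 = - g 1 1 ∧
    (S * g) 1 0 = g 0 0 ∧ (S * g) 1 1 = g 0 1 := by
  simp [coe_S, Matrix.mul_apply, Fin.sum_univ_two]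

open ModularGroup in
lemma S_S (g : SL(2, ℤ)) : S * (S * g) = -g := by
  obtain ⟨h1, h2, h3, h4⟩ := S_entries g
  obtain ⟨k1, k2, k3, k4⟩ := S_entries (S * g)
  ext i j
  rw [SpecialLinearGroup.coe_neg, Matrix.neg_apply]
  fin_cases i <;> fin_cases j
  · exact k1.trans (by rw [h3]; rfl)
  · exact k2.trans (by rw [h4]; rfl)
  · exact k3.trans h1
  · exact k4.trans h2

lemma GE_T (a : ℤ) (k : ℕ) (hk : 0 < k) (d : ℤ) (x y : ℝ) :
    GE (a + k) k d x y = 1/2 * psi2 x + GE a k d x (x + y) := by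
  have hk' : (k : ℝ) ≠ 0 := by positivity
  have : sN (a + k) k x y = sN a k x (x + y) := by
    unfold sN
    refine Finset.sum_congr rfl fun i _ => ?_
    rw [← B1_add_int (a * (i + x) / k + (x + y)) i]
    congr 2
    push_cast; field_simp; ring
  unfold GE
  rw [this]
  have e : x * ((a + k : ℤ) : ℝ) + y * k = x * a + (x + y) * k := by push_cast; ring
  rw [e]; push_cast; field_simp; ring

open ModularGroup in
lemma FE_T_mul (g : SL(2, ℤ)) (x y : ℝ) :
    FE (T * g) x y = 1/2 * psi2 x + FE g x (x + y) := by
  obtain ⟨h1, h2, h3, h4⟩ := T_entries g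
  have hdet := det_eq g
  unfold FE
  rw [h1, h2, h3, h4]
  rcases lt_trichotomy (g 1 0) 0 with h | h | h
  · have hn : ¬ 0 < g 1 0 := by omega
    rw [if_neg hn, if_pos h, if_neg hn, if_pos h, ← GE_T _ _ (by omega)]
    congr 1
    omega
  · rw [if_neg (by omega), if_neg (by omega), if_neg (by omega), if_neg (by omega)]
    rw [h] at hdet
    have : g 1 1 * g 1 1 = 1 := by
      rcases Int.isUnit_iff.mp (IsUnit.of_mul_eq_one_right (g 0 0) (by linarith : g 0 0 * g 1 1 = 1)) with h | h <;> rw [h] <;> norm_num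
    have : (g 1 1 : ℝ) * g 1 1 = 1 := by exact_mod_cast this
    push_cast
    linear_combination (1/2 * psi2 x) * this
  · rw [if_pos h, if_pos h, ← GE_T _ _ (by omega)]
    congr 1
    omega

lemma GE_S (a c : ℕ) (b d : ℤ) (ha : 0 < a) (hc : 0 < c) (hdet : (a:ℤ) * d - b * c = 1) (x y : ℝ)
    (hxy : ¬ (Int.fract x = 0 ∧ Int.fract y = 0)) :
    GE (-c) a b x y = - (B1 x * B1 y) + GE a c d y (-x) := by
  have ha' : (a : ℝ) ≠ 0 := by positivity
  have hc' : (c : ℝ) ≠ 0 := by positivity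
  have hr := recip a c ha hc ⟨d, -b, by linarith⟩ (-x) y (by
    rwa [Int.fract_neg_eq_zero])
  have h1 : sN (-c) a x y = - sN c a (-x) y := by
    have := sN_neg' c a x (-y)
    rw [neg_neg] at this
    rw [this, ← sN_neg c a ha x (-y), neg_neg]
  unfold GE
  rw [h1]
  rw [B1_neg, psi2_neg] at hr
  have e1 : (a:ℝ) * y + c * (-x) = y * a - x * c := by ring
  have e2 : x * ((-c : ℤ):ℝ) + y * a = y * a - x * c := by push_cast; ring
  have e3 : y * ((a : ℤ):ℝ) + -x * c = y * a - x * c := by push_cast; ring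
  rw [e1] at hr
  rw [e2, e3]
  have hd : (a:ℝ) * d - b * c = 1 := by exact_mod_cast hdet
  have hd' : (b : ℝ) / (2 * a) = d / (2 * c) - 1 / (2 * (a * c)) := by
    field_simp; linarith
  rw [hd']
  push_cast
  linear_combination hr

def QS (g : SL(2, ℤ)) : Prop := ∀ x y : ℝ, ¬ (Int.fract x = 0 ∧ Int.fract y = 0) →
  FE (ModularGroup.S * g) x y = - (B1 x * B1 y) + FE g y (-x)

lemma QS_neg (g : SL(2, ℤ)) (h : QS (-g)) : QS g := by
  intro x y hxy
  have := h x y hxy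
  rwa [mul_neg, FE_neg, FE_neg] at this

lemma QS_S (g : SL(2, ℤ)) (h : QS (ModularGroup.S * g)) : QS g := by
  intro x y hxy
  have := h y (-x) (by rw [Int.fract_neg_eq_zero]; tauto)
  rw [S_S, FE_neg, FE_neg_vec, B1_neg] at this
  linarith

lemma QS_pos (g : SL(2, ℤ)) (ha : 0 < g 0 0) (hc : 0 < g 1 0) : QS g := by
  intro x y hxy
  obtain ⟨h1, h2, h3, h4⟩ := S_entries g
  unfold FE
  rw [h1, h3, h4, if_pos ha, if_pos hc]
  have := GE_S (g 0 0).toNat (g 1 0).toNat (g 0 1) (g 1 1) (by omega) (by omega) (by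
    rw [Int.toNat_of_nonneg ha.le, Int.toNat_of_nonneg hc.le]; exact det_eq g) x y hxy
  rwa [Int.toNat_of_nonneg ha.le, Int.toNat_of_nonneg hc.le] at this

lemma GE_zero (d : ℤ) (x y : ℝ) : GE 0 1 d x y = d / 2 * psi2 y - B1 x * B1 y := by
  simp [GE, sN]

lemma QS_zero (g : SL(2, ℤ)) (hc : g 1 0 = 0) : QS g := by
  intro x y hxy
  obtain ⟨h1, h2, h3, h4⟩ := S_entries g
  have hdet := det_eq g
  rw [hc] at hdet
  unfold FE
  rw [h1, h3, h4, hc]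
  have hh : g 0 0 * g 1 1 = 1 := by linarith
  rcases Int.isUnit_iff.mp (IsUnit.of_mul_eq_one _ hh) with h | h
  · have : g 1 1 = 1 := by rw [h] at hh; linarith
    rw [h, this]
    simp [GE_zero]; ring
  · have : g 1 1 = -1 := by rw [h] at hh; linarith
    rw [h, this]
    simp [GE_zero]; ring

lemma QS_all (g : SL(2, ℤ)) : QS g := by
  obtain ⟨h1, h2, h3, h4⟩ := S_entries g
  rcases lt_trichotomy (g 1 0) 0 with hc | hc | hc
  · rcases lt_trichotomy (g 0 0) 0 with ha | ha | ha
    · exact QS_neg g (QS_pos _ (by simpa using ha) (by simpa using hc))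
    · exact QS_S g (QS_zero _ (by rw [h3, ha]))
    · exact QS_S g (QS_pos _ (by rw [h1]; omega) (by rw [h3]; omega))
  · exact QS_zero g hc
  · rcases lt_trichotomy (g 0 0) 0 with ha | ha | ha
    · refine QS_S g (QS_neg _ (QS_pos _ ?_ ?_))
      · rw [SpecialLinearGroup.coe_neg, Matrix.neg_apply, h1]; omega
      · rw [SpecialLinearGroup.coe_neg, Matrix.neg_apply, h3]; omega
    · exact QS_S g (QS_zero _ (by rw [h3, ha]))
    · exact QS_pos g ha hc

/-- The cocycle property with left factor `g`. -/
def PC (g : SL(2, ℤ)) : Prop := ∀ (h : SL(2, ℤ)) (x y : ℝ), ¬ (Int.fract x = 0 ∧ Int.fract y = 0) →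
  FE (g * h) x y = FE g x y + FE h (x * g 0 0 + y * g 1 0) (x * g 0 1 + y * g 1 1)

lemma FE_one (x y : ℝ) : FE 1 x y = 0 := by
  simp [FE]

lemma int_comb {x y : ℝ} (g : SL(2, ℤ)) (hxy : ¬ (Int.fract x = 0 ∧ Int.fract y = 0)) :
    ¬ (Int.fract (x * g 0 0 + y * g 1 0) = 0 ∧ Int.fract (x * g 0 1 + y * g 1 1) = 0) := by
  rintro ⟨h1, h2⟩
  apply hxy
  have hd : (g 0 0 : ℝ) * g 1 1 - g 0 1 * g 1 0 = 1 := by exact_mod_cast det_eq g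
  rw [Int.fract_eq_zero_iff] at *
  obtain ⟨m, hm⟩ := h1
  obtain ⟨n, hn⟩ := h2
  rw [Int.fract_eq_zero_iff]
  refine ⟨⟨m * g 1 1 - n * g 1 0, ?_⟩, ⟨- m * g 0 1 + n * g 0 0, ?_⟩⟩
  · push_cast; rw [hm, hn]; linear_combination x * hd
  · push_cast; rw [hm, hn]; linear_combination y * hd

lemma mul_entries (g h : SL(2, ℤ)) (i j : Fin 2) : (g * h) i j = g i 0 * h 0 j + g i 1 * h 1 j := by
  simp [Matrix.mul_apply, Fin.sum_univ_two]

lemma PC_mul (g₁ g₂ : SL(2, ℤ)) (h₁ : PC g₁) (h₂ : PC g₂) : PC (g₁ * g₂) := by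
  intro h x y hxy
  rw [mul_assoc, h₁ (g₂ * h) x y hxy, h₂ h _ _ (int_comb g₁ hxy), h₁ g₂ x y hxy, add_assoc]
  congr 3
  · rw [mul_entries, mul_entries]; push_cast; ring
  · rw [mul_entries, mul_entries]; push_cast; ring

lemma PC_inv (g : SL(2, ℤ)) (hg : PC g) : PC g⁻¹ := by
  intro h x y hxy
  have hn := int_comb g⁻¹ hxy
  have e : ∀ i j, ((g⁻¹ * g : SL(2, ℤ)) i j) = (1 : SL(2, ℤ)) i j := by rw [inv_mul_cancel]; simp
  have e1 : ∀ i j, ((g⁻¹ i 0 * g 0 j + g⁻¹ i 1 * g 1 j : ℤ) : ℝ) = ((1 : SL(2, ℤ)) i j : ℤ) := by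
    intro i j; rw [← e i j, mul_entries]
  have h00 := e1 0 0
  have h01 := e1 0 1
  have h10 := e1 1 0
  have h11 := e1 1 1
  rw [show (1 : SL(2, ℤ)) 0 0 = 1 from rfl] at h00
  rw [show (1 : SL(2, ℤ)) 0 1 = 0 from rfl] at h01
  rw [show (1 : SL(2, ℤ)) 1 0 = 0 from rfl] at h10
  rw [show (1 : SL(2, ℤ)) 1 1 = 1 from rfl] at h11
  push_cast at h00 h01 h10 h11
  have a1 := hg (g⁻¹ * h) _ _ hn
  have a2 := hg g⁻¹ _ _ hn
  rw [mul_inv_cancel, FE_one] at a2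
  rw [mul_inv_cancel_left] at a1
  have ex : (x * g⁻¹ 0 0 + y * g⁻¹ 1 0) * g 0 0 + (x * g⁻¹ 0 1 + y * g⁻¹ 1 1) * g 1 0 = x := by
    linear_combination x * h00 + y * h10
  have ey : (x * g⁻¹ 0 0 + y * g⁻¹ 1 0) * g 0 1 + (x * g⁻¹ 0 1 + y * g⁻¹ 1 1) * g 1 1 = y := by
    linear_combination x * h01 + y * h11
  rw [ex, ey] at a1 a2
  linarith

open ModularGroup in
lemma PC_T : PC T := by
  intro h x y hxy
  rw [FE_T_mul]
  have := FE_T_mul 1 x y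
  rw [mul_one, FE_one] at this
  rw [this]
  simp [coe_T]

open ModularGroup in
lemma PC_S : PC S := by
  intro h x y hxy
  rw [QS_all h x y hxy]
  have := QS_all 1 x y hxy
  rw [mul_one, FE_one] at this
  rw [this]
  simp [coe_S]

lemma PC_all (g : SL(2, ℤ)) : PC g := by
  have hg : g ∈ Subgroup.closure {ModularGroup.S, ModularGroup.T} := by
    rw [SpecialLinearGroup.SL2Z_generators]; trivial
  induction hg using Subgroup.closure_induction with
  | mem x hx =>
    rcases hx with rfl | rfl
    · exact PC_S
    · exact PC_T
  | one => intro h x y _; rw [one_mul, FE_one]; simp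
  | mul x y _ _ hx hy => exact PC_mul x y hx hy
  | inv x _ hx => exact PC_inv x hx

lemma sum_range_mul_split (q k : ℕ) (hq : 0 < q) (f : ℕ → ℂ) :
    ∑ j ∈ Finset.range (q * k), f j =
      ∑ r ∈ Finset.range q, ∑ m ∈ Finset.range k, f (r + q * m) := by
  rw [← Finset.sum_product']
  refine Finset.sum_bij' (fun j _ => (j % q, j / q)) (fun p _ => p.1 + q * p.2) ?_ ?_ ?_ ?_ ?_
  · intro j hj
    simp only [Finset.mem_product, Finset.mem_range] at *
    exact ⟨Nat.mod_lt _ hq, Nat.div_lt_of_lt_mul hj⟩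
  · rintro ⟨r, m⟩ h
    simp only [Finset.mem_product, Finset.mem_range] at *
    calc r + q * m < q + q * m := by omega
      _ = q * (m + 1) := by ring
      _ ≤ q * k := Nat.mul_le_mul_left _ h.2
  · intro j _; exact Nat.mod_add_div j q
  · rintro ⟨r, m⟩ h
    simp only [Finset.mem_product, Finset.mem_range] at h
    simp [Nat.add_mul_mod_self_left, Nat.mod_eq_of_lt h.1, Nat.add_mul_div_left _ _ hq,
      Nat.div_eq_of_lt h.1]
  · intro j _
    rw [Nat.mod_add_div j q]

/-- Character weighted sum. -/
noncomputable def wsum {q₁ q₂ : ℕ} (χ₁ : DirichletCharacter ℂ q₁)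
    (χ₂ : DirichletCharacter ℂ q₂) (f : ℝ → ℝ → ℝ) : ℂ :=
  ∑ r ∈ Finset.range q₂, ∑ n ∈ Finset.range q₁,
    (starRingEnd ℂ) (χ₂ (r : ZMod q₂)) * (starRingEnd ℂ) (χ₁ (n : ZMod q₁)) *
      ((f ((r : ℝ) / q₂) ((n : ℝ) / q₁) : ℝ) : ℂ)

lemma ded_eq {q₁ q₂ : ℕ} (hq₂ : 0 < q₂) (χ₁ : DirichletCharacter ℂ q₁)
    (χ₂ : DirichletCharacter ℂ q₂) (a : ℤ) (k : ℕ) (hk : 0 < k) :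
    ded χ₁ χ₂ a ((q₂ * k : ℕ) : ℤ) = wsum χ₁ χ₂ (sN a k) := by
  unfold ded wsum
  have hk' : (k : ℝ) ≠ 0 := by positivity
  have hq' : (q₂ : ℝ) ≠ 0 := by positivity
  rw [Int.toNat_natCast, sum_range_mul_split q₂ k hq₂]
  refine Finset.sum_congr rfl fun r _ => ?_
  rw [Finset.sum_comm]
  refine Finset.sum_congr rfl fun n _ => ?_
  unfold sN
  rw [Complex.ofReal_sum, Finset.mul_sum]
  refine Finset.sum_congr rfl fun m _ => ?_
  have e1 : ((r + q₂ * m : ℕ) : ZMod q₂) = (r : ZMod q₂) := by simp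
  rw [e1]
  congr 4
  · push_cast; field_simp; ring
  · push_cast; field_simp; ring

lemma prim_sum_zero {q : ℕ} (hq : 1 < q) (χ : DirichletCharacter ℂ q) (h : χ.IsPrimitive) :
    ∑ n ∈ Finset.range q, (starRingEnd ℂ) (χ (n : ZMod q)) = 0 := by
  have : NeZero q := ⟨by omega⟩
  have hne : χ ≠ 1 := by
    rintro rfl
    rw [DirichletCharacter.isPrimitive_def, DirichletCharacter.conductor_one] at h
    omega
  rw [← map_sum]
  have e : ∑ n ∈ Finset.range q, χ (n : ZMod q) = ∑ z : ZMod q, χ z := by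
    refine Finset.sum_bij' (fun i _ => (i : ZMod q)) (fun z _ => z.val) ?_ ?_ ?_ ?_ ?_
    · simp
    · intro z _; simp [ZMod.val_lt]
    · intro i hi; exact ZMod.val_cast_of_lt (Finset.mem_range.mp hi)
    · intro z _; simp
    · simp
  rw [e, MulChar.sum_eq_zero_of_ne_one hne, map_zero]

lemma wsum_fst {q₁ q₂ : ℕ} (hq₁ : 1 < q₁) (χ₁ : DirichletCharacter ℂ q₁)
    (χ₂ : DirichletCharacter ℂ q₂) (h : χ₁.IsPrimitive) (f : ℝ → ℝ) :
    wsum χ₁ χ₂ (fun x _ => f x) = 0 := by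
  unfold wsum
  refine Finset.sum_eq_zero fun r _ => ?_
  rw [← Finset.sum_mul, ← Finset.mul_sum, prim_sum_zero hq₁ χ₁ h]
  simp

lemma wsum_add {q₁ q₂ : ℕ} (χ₁ : DirichletCharacter ℂ q₁)
    (χ₂ : DirichletCharacter ℂ q₂) (f g : ℝ → ℝ → ℝ) :
    wsum χ₁ χ₂ (fun x y => f x y + g x y) = wsum χ₁ χ₂ f + wsum χ₁ χ₂ g := by
  unfold wsum
  simp only [← Finset.sum_add_distrib]
  refine Finset.sum_congr rfl fun r _ => Finset.sum_congr rfl fun n _ => ?_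
  push_cast; ring

lemma wsum_congr {q₁ q₂ : ℕ} (hq₂ : 1 < q₂) (χ₁ : DirichletCharacter ℂ q₁)
    (χ₂ : DirichletCharacter ℂ q₂) (f g : ℝ → ℝ → ℝ)
    (h : ∀ r n : ℕ, Int.fract ((r : ℝ) / q₂) ≠ 0 →
      f ((r : ℝ) / q₂) ((n : ℝ) / q₁) = g ((r : ℝ) / q₂) ((n : ℝ) / q₁)) :
    wsum χ₁ χ₂ f = wsum χ₁ χ₂ g := by
  unfold wsum
  refine Finset.sum_congr rfl fun r hr => Finset.sum_congr rfl fun n _ => ?_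
  rw [Finset.mem_range] at hr
  have hq : (0 : ℝ) < q₂ := by exact_mod_cast (by omega : 0 < q₂)
  by_cases hr0 : r = 0
  · have : Fact (1 < q₂) := ⟨hq₂⟩
    have : χ₂ ((r : ℕ) : ZMod q₂) = 0 := by
      rw [hr0, Nat.cast_zero]; exact MulChar.map_zero χ₂
    rw [this]; simp
  · rw [h]
    have hrq : (r : ℝ) < q₂ := by exact_mod_cast hr
    rw [Int.fract_eq_self.mpr ⟨by positivity, by rw [div_lt_one hq]; exact hrq⟩]
    have : (r : ℝ) ≠ 0 := by exact_mod_cast hr0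
    positivity

lemma wsum_GE {q₁ q₂ : ℕ} (hq₁ : 1 < q₁) (hq₂ : 1 < q₂) (χ₁ : DirichletCharacter ℂ q₁)
    (χ₂ : DirichletCharacter ℂ q₂) (h : χ₁.IsPrimitive) (a d : ℤ) (k : ℕ)
    (hk : q₁ ∣ k) (ha : (∃ e : ℤ, a = 1 + q₂ * e) ∨ (∃ e : ℤ, a = -1 + q₂ * e)) :
    wsum χ₁ χ₂ (sN a k) + wsum χ₁ χ₂ (GE a k d) = 0 := by
  rw [← wsum_add, ← wsum_fst (q₂ := q₂) hq₁ χ₁ χ₂ h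
    (fun x => (a / (2 * k) + d / (2 * k)) * psi2 x)]
  refine wsum_congr hq₂ _ _ _ _ fun r n _ => ?_
  have hq1 : (q₁ : ℝ) ≠ 0 := by exact_mod_cast (by omega : q₁ ≠ 0)
  have hq2 : (q₂ : ℝ) ≠ 0 := by exact_mod_cast (by omega : q₂ ≠ 0)
  have : psi2 ((r : ℝ) / q₂ * a + (n : ℝ) / q₁ * k) = psi2 ((r : ℝ) / q₂) := by
    obtain ⟨l, rfl⟩ := hk
    rcases ha with ⟨e, rfl⟩ | ⟨e, rfl⟩
    · rw [← psi2_add_int ((r : ℝ) / q₂) (r * e + n * l)]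
      congr 1; push_cast; field_simp; ring
    · rw [← psi2_neg ((r : ℝ) / q₂), ← psi2_add_int (-((r : ℝ) / q₂)) (r * e + n * l)]
      congr 1; push_cast; field_simp; ring
  unfold GE
  rw [this]; ring

lemma dedSL_eq {q₁ q₂ : ℕ} (hq₁ : 1 < q₁) (hq₂ : 1 < q₂) (χ₁ : DirichletCharacter ℂ q₁)
    (χ₂ : DirichletCharacter ℂ q₂) (h : χ₁.IsPrimitive) (γ g : SL(2, ℤ))
    (h00 : g 0 0 = γ 0 0) (h10 : γ 1 0 = q₂ * g 1 0)
    (hc : (q₁ : ℤ) ∣ g 1 0) (ha : ∃ e : ℤ, g 0 0 = 1 + q₂ * e) :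
    dedSL χ₁ χ₂ γ + wsum χ₁ χ₂ (FE g) = 0 := by
  have hq2 : (0 : ℤ) < q₂ := by exact_mod_cast (by omega : 0 < q₂)
  unfold dedSL
  rcases lt_trichotomy (g 1 0) 0 with hg | hg | hg
  · have hn : γ 1 0 < 0 := by rw [h10]; exact mul_neg_of_pos_of_neg hq2 hg
    have hn' : ¬ 0 < γ 1 0 := by omega
    have hgn : ¬ 0 < g 1 0 := by omega
    obtain ⟨k, hk⟩ := Int.eq_ofNat_of_zero_le (by omega : 0 ≤ - g 1 0)
    have e : - γ 1 0 = ((q₂ * k : ℕ) : ℤ) := by rw [h10]; push_cast; rw [← hk]; ring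
    rw [if_neg hn', if_pos hn, e, ded_eq (by omega) _ _ _ _ (by omega), ← h00]
    have eF : FE g = GE (- g 0 0) k (- g 1 1) := by
      funext x y
      unfold FE
      rw [if_neg hgn, if_pos hg, hk, Int.toNat_natCast]
    rw [eF]
    refine wsum_GE hq₁ hq₂ _ _ h _ _ _ ?_ (Or.inr ?_)
    · rw [← Int.natCast_dvd_natCast, ← hk]; exact hc.neg_right
    · obtain ⟨e, he⟩ := ha
      exact ⟨-e, by rw [he]; ring⟩
  · have hn : γ 1 0 = 0 := by rw [h10, hg, mul_zero]
    have eF : FE g = fun x _ => (g 0 1 * g 1 1 / 2 * psi2 x : ℝ) := by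
      funext x y
      unfold FE
      rw [hg]; simp
    rw [eF, wsum_fst hq₁ χ₁ χ₂ h, hn]; simp
  · have hn : 0 < γ 1 0 := by rw [h10]; exact mul_pos hq2 hg
    obtain ⟨k, hk⟩ := Int.eq_ofNat_of_zero_le (by omega : 0 ≤ g 1 0)
    have e : γ 1 0 = ((q₂ * k : ℕ) : ℤ) := by rw [h10]; push_cast; rw [← hk]
    rw [if_pos hn, e, ded_eq (by omega) _ _ _ _ (by omega), ← h00]
    have eF : FE g = GE (g 0 0) k (g 1 1) := by
      funext x y
      unfold FE
      rw [if_pos hg, hk, Int.toNat_natCast]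
    rw [eF]
    refine wsum_GE hq₁ hq₂ _ _ h _ _ _ ?_ (Or.inl ha)
    rw [← Int.natCast_dvd_natCast, ← hk]; exact hc

/-- `g` is the conjugate of `γ` by `diag(q₂, 1)` for `γ ∈ Γ₁(q₁q₂)`. -/
structure IsConj' (q₁ q₂ : ℕ) (γ g : SL(2, ℤ)) : Prop where
  h00 : g 0 0 = γ 0 0
  h01 : g 0 1 = q₂ * γ 0 1
  h10 : γ 1 0 = q₂ * g 1 0
  h11 : g 1 1 = γ 1 1
  hc : (q₁ : ℤ) ∣ g 1 0
  ha : ∃ e : ℤ, g 0 0 = 1 + q₂ * e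
  hd : ∃ e : ℤ, g 1 1 = 1 + q₁ * e

lemma exists_conj {q₁ q₂ : ℕ} (γ : SL(2, ℤ)) (h : γ ∈ Gamma1 (q₁ * q₂)) :
    ∃ g, IsConj' q₁ q₂ γ g := by
  rw [Gamma1_mem] at h
  obtain ⟨h1, h2, h3⟩ := h
  rw [ZMod.intCast_zmod_eq_zero_iff_dvd] at h3
  have h1' : ((γ 0 0 - 1 : ℤ) : ZMod (q₁ * q₂)) = 0 := by push_cast; rw [h1, sub_self]
  have h2' : ((γ 1 1 - 1 : ℤ) : ZMod (q₁ * q₂)) = 0 := by push_cast; rw [h2, sub_self]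
  rw [ZMod.intCast_zmod_eq_zero_iff_dvd] at h1' h2'
  obtain ⟨u, hu⟩ := h1'
  obtain ⟨v, hv⟩ := h2'
  obtain ⟨w, hw⟩ := h3
  push_cast at hu hv hw
  have hdet := det_eq γ
  refine ⟨⟨!![γ 0 0, q₂ * γ 0 1; q₁ * w, γ 1 1], ?_⟩, ?_⟩
  · rw [Matrix.det_fin_two_of]; rw [hw] at hdet; linear_combination hdet
  · refine ⟨rfl, rfl, ?_, rfl, ⟨w, rfl⟩, ⟨q₁ * u, ?_⟩, ⟨q₂ * v, ?_⟩⟩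
    · change γ 1 0 = q₂ * (q₁ * w)
      rw [hw]; ring
    · change γ 0 0 = _
      linear_combination hu
    · change γ 1 1 = _
      linear_combination hv

lemma IsConj'.mul {q₁ q₂ : ℕ} {γ₁ γ₂ g₁ g₂ : SL(2, ℤ)} (h₁ : IsConj' q₁ q₂ γ₁ g₁)
    (h₂ : IsConj' q₁ q₂ γ₂ g₂) : IsConj' q₁ q₂ (γ₁ * γ₂) (g₁ * g₂) := by
  obtain ⟨a1, b1, c1, d1, ⟨w1, hw1⟩, ⟨u1, hu1⟩, ⟨v1, hv1⟩⟩ := h₁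
  obtain ⟨a2, b2, c2, d2, ⟨w2, hw2⟩, ⟨u2, hu2⟩, ⟨v2, hv2⟩⟩ := h₂
  refine ⟨?_, ?_, ?_, ?_, ?_, ?_, ?_⟩
  · rw [mul_entries, mul_entries, a1, a2, b1, c2]; ring
  · rw [mul_entries, mul_entries, a1, b2, b1, d2]; ring
  · rw [mul_entries, mul_entries, c1, ← a2, c2, ← d1]; ring
  · rw [mul_entries, mul_entries, b2, c1, d1, d2]; ring
  · rw [mul_entries, hw1, hw2]
    exact ⟨w1 * g₂ 0 0 + g₁ 1 1 * w2, by ring⟩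
  · rw [mul_entries, hu1, hu2, b1]
    exact ⟨u1 + u2 + q₂ * u1 * u2 + γ₁ 0 1 * g₂ 1 0, by ring⟩
  · rw [mul_entries, hv1, hv2, hw1]
    exact ⟨v1 + v2 + q₁ * v1 * v2 + w1 * g₂ 0 1, by ring⟩

lemma dedSL_mul {q₁ q₂ : ℕ} (hq₁ : 1 < q₁) (hq₂ : 1 < q₂) (χ₁ : DirichletCharacter ℂ q₁)
    (χ₂ : DirichletCharacter ℂ q₂) (h : χ₁.IsPrimitive) (γ₁ γ₂ : SL(2, ℤ))
    (hγ₁ : γ₁ ∈ Gamma1 (q₁ * q₂)) (hγ₂ : γ₂ ∈ Gamma1 (q₁ * q₂)) :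
    dedSL χ₁ χ₂ (γ₁ * γ₂) = dedSL χ₁ χ₂ γ₁ + dedSL χ₁ χ₂ γ₂ := by
  obtain ⟨g₁, h₁⟩ := exists_conj γ₁ hγ₁
  obtain ⟨g₂, h₂⟩ := exists_conj γ₂ hγ₂
  have h₃ := h₁.mul h₂
  have s1 := dedSL_eq hq₁ hq₂ χ₁ χ₂ h γ₁ g₁ h₁.h00 h₁.h10 h₁.hc h₁.ha
  have s2 := dedSL_eq hq₁ hq₂ χ₁ χ₂ h γ₂ g₂ h₂.h00 h₂.h10 h₂.hc h₂.ha
  have s3 := dedSL_eq hq₁ hq₂ χ₁ χ₂ h _ _ h₃.h00 h₃.h10 h₃.hc h₃.ha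
  have key : wsum χ₁ χ₂ (FE (g₁ * g₂)) = wsum χ₁ χ₂ (FE g₁) + wsum χ₁ χ₂ (FE g₂) := by
    rw [← wsum_add]
    refine wsum_congr hq₂ _ _ _ _ fun r n hr => ?_
    rw [PC_all g₁ g₂ _ _ (fun hh => hr hh.1)]
    congr 1
    have hq1 : (q₁ : ℝ) ≠ 0 := by exact_mod_cast (by omega : q₁ ≠ 0)
    have hq2 : (q₂ : ℝ) ≠ 0 := by exact_mod_cast (by omega : q₂ ≠ 0)
    obtain ⟨w, hw⟩ := h₁.hc
    obtain ⟨u, hu⟩ := h₁.ha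
    obtain ⟨v, hv⟩ := h₁.hd
    rw [← FE_add_int g₂ ((r : ℝ) / q₂) ((n : ℝ) / q₁) (r * u + n * w) (r * γ₁ 0 1 + n * v)]
    rw [hw, hu, hv, h₁.h01]
    congr 1
    · push_cast; field_simp; ring
    · push_cast; field_simp; ring
  rw [key] at s3
  linear_combination s3 - s1 - s2

lemma dedSL_one {q₁ q₂ : ℕ} (χ₁ : DirichletCharacter ℂ q₁) (χ₂ : DirichletCharacter ℂ q₂) :
    dedSL χ₁ χ₂ 1 = 0 := by
  simp [dedSL]

/-- The kernel as a subgroup. -/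
def kerSub {q₁ q₂ : ℕ} (hq₁ : 1 < q₁) (hq₂ : 1 < q₂) : Subgroup SL(2, ℤ) where
  carrier := {γ : SL(2, ℤ) | γ ∈ Gamma1 (q₁ * q₂) ∧
        ∀ (χ₁ : DirichletCharacter ℂ q₁) (χ₂ : DirichletCharacter ℂ q₂),
          χ₁.IsPrimitive → χ₂.IsPrimitive → χ₁ (-1) * χ₂ (-1) = 1 →
            dedSL χ₁ χ₂ γ = 0}
  one_mem' := ⟨one_mem _, fun χ₁ χ₂ _ _ _ => dedSL_one χ₁ χ₂⟩
  mul_mem' := by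
    rintro a b ⟨ha, ha'⟩ ⟨hb, hb'⟩
    refine ⟨mul_mem ha hb, fun χ₁ χ₂ h1 h2 h3 => ?_⟩
    rw [dedSL_mul hq₁ hq₂ χ₁ χ₂ h1 a b ha hb, ha' χ₁ χ₂ h1 h2 h3, hb' χ₁ χ₂ h1 h2 h3, add_zero]
  inv_mem' := by
    rintro a ⟨ha, ha'⟩
    refine ⟨inv_mem ha, fun χ₁ χ₂ h1 h2 h3 => ?_⟩
    have := dedSL_mul hq₁ hq₂ χ₁ χ₂ h1 a a⁻¹ ha (inv_mem ha)
    rw [mul_inv_cancel, dedSL_one, ha' χ₁ χ₂ h1 h2 h3, zero_add] at this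
    exact this.symm

lemma comm_le {q₁ q₂ : ℕ} (hq₁ : 1 < q₁) (hq₂ : 1 < q₂) :
    ⁅Gamma (q₁ * q₂), Gamma (q₁ * q₂)⁆ ≤ kerSub hq₁ hq₂ := by
  have hle : ∀ g ∈ Gamma (q₁ * q₂), g ∈ Gamma1 (q₁ * q₂) := by
    intro g hg
    rw [Gamma_mem] at hg
    rw [Gamma1_mem]
    exact ⟨hg.1, hg.2.2.2, hg.2.2.1⟩
  rw [Subgroup.commutator_le]
  intro a ha b hb
  have ha := hle a ha
  have hb := hle b hb
  rw [commutatorElement_def]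
  have hab : a * b * a⁻¹ * b⁻¹ ∈ Gamma1 (q₁ * q₂) :=
    mul_mem (mul_mem (mul_mem ha hb) (inv_mem ha)) (inv_mem hb)
  refine ⟨hab, fun χ₁ χ₂ h1 h2 h3 => ?_⟩
  have e1 := dedSL_mul hq₁ hq₂ χ₁ χ₂ h1 (a * b * a⁻¹ * b⁻¹) (b * a) hab (mul_mem hb ha)
  have e : (a * b * a⁻¹ * b⁻¹) * (b * a) = a * b := by group
  rw [e, dedSL_mul hq₁ hq₂ χ₁ χ₂ h1 a b ha hb, dedSL_mul hq₁ hq₂ χ₁ χ₂ h1 b a hb ha] at e1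
  linear_combination -e1

/-- `[Γ(q₁q₂), Γ(q₁q₂)] ⊊ K¹_{q₁,q₂}`. -/
theorem commutator_strict_subset_kernel {q₁ q₂ : ℕ} (hq₁ : 1 < q₁) (hq₂ : 1 < q₂) :
    ((⁅Gamma (q₁ * q₂), Gamma (q₁ * q₂)⁆ : Subgroup SL(2, ℤ)) : Set SL(2, ℤ)) ⊂
      {γ : SL(2, ℤ) | γ ∈ Gamma1 (q₁ * q₂) ∧
        ∀ (χ₁ : DirichletCharacter ℂ q₁) (χ₂ : DirichletCharacter ℂ q₂),
          χ₁.IsPrimitive → χ₂.IsPrimitive → χ₁ (-1) * χ₂ (-1) = 1 →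
            dedSL χ₁ χ₂ γ = 0} := by
  refine ⟨fun γ hγ => comm_le hq₁ hq₂ hγ, fun hsub => ?_⟩
  have hT : ModularGroup.T ∈ ⁅Gamma (q₁ * q₂), Gamma (q₁ * q₂)⁆ := by
    apply hsub
    refine ⟨?_, fun χ₁ χ₂ _ _ _ => ?_⟩
    · rw [Gamma1_mem]; simp [ModularGroup.coe_T]
    · simp [dedSL, ModularGroup.coe_T]
  have hT' : ModularGroup.T ∈ Gamma (q₁ * q₂) := Subgroup.commutator_le_self _ hT
  rw [Gamma_mem] at hT'
  have h01 := hT'.2.1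
  have h1 : (ModularGroup.T 0 1 : ℤ) = 1 := by simp [ModularGroup.coe_T]
  rw [h1] at h01
  have hlt : 1 < q₁ * q₂ := by nlinarith
  have : Fact (1 < q₁ * q₂) := ⟨hlt⟩
  simp at h01
end

section
/- The newform Dedekind sum vanishes at (q₁q₂ − 1, q₁q₂): S_{χ₁,χ₂}(q₁q₂ − 1, q₁q₂) = 0. -/
open scoped MatrixGroups
open CongruenceSubgroup Matrix

theorem sum_range_zmod_s14 (q : ℕ) [NeZero q] (F : ℕ → ℂ) :
    ∑ n ∈ Finset.range q, F n = ∑ x : ZMod q, F x.val := by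
  symm
  refine Finset.sum_bij (fun x _ => x.val) ?_ ?_ ?_ ?_
  · intro x _
    exact Finset.mem_range.2 (ZMod.val_lt x)
  · intro x _ y _ h
    exact ZMod.val_injective q h
  · intro n hn
    exact ⟨(n : ZMod q), Finset.mem_univ _, ZMod.val_cast_of_lt (Finset.mem_range.1 hn)⟩
  · intro x _
    rfl

theorem sum_range_split (a b : ℕ) (F : ℕ → ℂ) :
    ∑ j ∈ Finset.range (a * b), F j
      = ∑ k ∈ Finset.range a, ∑ r ∈ Finset.range b, F (r + b * k) := by
  rw [Finset.sum_range, ← finProdFinEquiv.sum_comp, Fintype.sum_prod_type, Finset.sum_range]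
  refine Finset.sum_congr rfl fun k _ => ?_
  rw [Finset.sum_range]
  rfl

theorem B1_of_eq (x y : ℝ) (h0 : 0 < y) (h1 : y < 1) (z : ℤ) (h : x - y = z) :
    B1 x = y - 1 / 2 := by
  have : Int.fract x = y := Int.fract_eq_iff.2 ⟨h0.le, h1, z, h⟩
  rw [B1, this, if_neg h0.ne']

theorem B1_key {q₁ q₂ : ℕ} [NeZero q₁] (r : ℕ) (h0 : 0 < r) (hr : r < q₂) (k n : ZMod q₁) :
    B1 ((n.val : ℝ) / q₁ + ((q₁ * q₂ : ℝ) - 1) * ((r : ℝ) + q₂ * k.val) / (q₁ * q₂))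
      = ((n - k - 1).val : ℝ) / q₁ + (1 / q₁ - (r : ℝ) / (q₁ * q₂)) - 1 / 2 := by
  have hq1 : (0 : ℝ) < q₁ := by exact_mod_cast Nat.pos_of_ne_zero (NeZero.ne q₁)
  have hq2 : (0 : ℝ) < q₂ := by exact_mod_cast h0.trans hr
  have hr0 : (0 : ℝ) < r := by exact_mod_cast h0
  have hr1 : (r : ℝ) < q₂ := by exact_mod_cast hr
  have hv : ((n - k - 1).val : ℝ) + 1 ≤ q₁ := by
    exact_mod_cast ZMod.val_lt (n - k - 1)
  have hv0 : (0 : ℝ) ≤ ((n - k - 1).val : ℝ) := Nat.cast_nonneg _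
  obtain ⟨z, hz⟩ : (q₁ : ℤ) ∣ (n.val : ℤ) - k.val - 1 - (n - k - 1).val := by
    rw [← ZMod.intCast_zmod_eq_zero_iff_dvd]
    push_cast
    simp
  have hz' : (n.val : ℝ) - k.val - 1 - (n - k - 1).val = q₁ * z := by exact_mod_cast hz
  have e : ((n - k - 1).val : ℝ) / q₁ + (1 / q₁ - (r : ℝ) / (q₁ * q₂))
      = (((n - k - 1).val : ℝ) * q₂ + (q₂ - r)) / (q₁ * q₂) := by
    field_simp
  apply B1_of_eq _ _ _ _ ((r + q₂ * k.val : ℤ) + z)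
  · push_cast
    have : (z : ℝ) = ((n.val : ℝ) - k.val - 1 - (n - k - 1).val) / q₁ := by
      rw [hz']; field_simp
    rw [this]
    field_simp
    ring
  · rw [e]
    apply div_pos _ (by positivity)
    have := mul_nonneg hv0 hq2.le
    linarith
  · rw [e, div_lt_one (by positivity)]
    nlinarith

theorem B1_key2 {q₁ q₂ : ℕ} [NeZero q₁] (r : ℕ) (h0 : 0 < r) (hr : r < q₂) (k : ZMod q₁) :
    B1 (((r : ℝ) + q₂ * k.val) / (q₁ * q₂))
      = (k.val : ℝ) / q₁ + (r : ℝ) / (q₁ * q₂) - 1 / 2 := by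
  have hq1 : (0 : ℝ) < q₁ := by exact_mod_cast Nat.pos_of_ne_zero (NeZero.ne q₁)
  have hq2 : (0 : ℝ) < q₂ := by exact_mod_cast h0.trans hr
  have hr0 : (0 : ℝ) < r := by exact_mod_cast h0
  have hr1 : (r : ℝ) < q₂ := by exact_mod_cast hr
  have hv : (k.val : ℝ) + 1 ≤ q₁ := by
    exact_mod_cast ZMod.val_lt k
  have hv0 : (0 : ℝ) ≤ (k.val : ℝ) := Nat.cast_nonneg _
  have e : (k.val : ℝ) / q₁ + (r : ℝ) / (q₁ * q₂) = ((r : ℝ) + q₂ * k.val) / (q₁ * q₂) := by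
    field_simp
    ring
  rw [e]
  apply B1_of_eq _ _ _ _ 0
  · simp
  · positivity
  · rw [div_lt_one (by positivity)]
    nlinarith

theorem inner_ded_sum {q : ℕ} [NeZero q] (ψ : ZMod q → ℂ) (hψ : ∑ n, ψ n = 0) (v : ZMod q → ℂ)
    (α β : ℂ) :
    ∑ k, ∑ n, ψ n * ((v k + α) * (v (n - k - 1) + β))
      = ∑ k, ∑ n, ψ n * (v k * v (n - k - 1)) := by
  have h1 : ∀ k n, ψ n * ((v k + α) * (v (n - k - 1) + β))
      = ψ n * (v k * v (n - k - 1)) + ψ n * ((v k + α) * β) + α * (ψ n * v (n - k - 1)) := by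
    intros; ring
  simp only [h1, Finset.sum_add_distrib, ← Finset.sum_mul, ← Finset.mul_sum, hψ]
  rw [Finset.sum_comm (f := fun k n => ψ n * v (n - k - 1))]
  have h2 : ∀ n, ∑ k, v (n - k - 1) = ∑ k, v k := by
    intro n
    have := ((Equiv.subLeft n).trans (Equiv.subRight (1 : ZMod q))).sum_comp v
    simpa using this
  simp only [← Finset.mul_sum, h2, ← Finset.sum_mul, hψ]
  simp

theorem sum_conj_char {q : ℕ} [NeZero q] (hq : 1 < q) (χ : DirichletCharacter ℂ q)
    (h : χ.IsPrimitive) : ∑ n : ZMod q, (starRingEnd ℂ) (χ n) = 0 := by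
  rw [← map_sum, MulChar.sum_eq_zero_of_ne_one, map_zero]
  rintro rfl
  rw [DirichletCharacter.IsPrimitive, DirichletCharacter.conductor_one] at h
  omega

/-- `S_{χ₁,χ₂}(q₁q₂ − 1, q₁q₂) = 0`. -/
theorem ded_q₁q₂_sub_one_eq_zero {q₁ q₂ : ℕ} (hq₁ : 1 < q₁) (hq₂ : 1 < q₂)
    (χ₁ : DirichletCharacter ℂ q₁) (χ₂ : DirichletCharacter ℂ q₂)
    (h₁ : χ₁.IsPrimitive) (h₂ : χ₂.IsPrimitive)
    (hpar : χ₁ (-1) * χ₂ (-1) = 1) :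
    ded χ₁ χ₂ (((q₁ * q₂ : ℕ) : ℤ) - 1) ((q₁ * q₂ : ℕ) : ℤ) = 0 := by 
  haveI : NeZero q₁ := ⟨by omega⟩
  haveI : NeZero q₂ := ⟨by omega⟩
  have s1 := sum_conj_char hq₁ χ₁ h₁
  have s2 := sum_conj_char hq₂ χ₂ h₂
  rw [ded, Int.toNat_natCast, sum_range_split, Finset.sum_comm]
  have key : ∀ r ∈ Finset.range q₂, (∑ k ∈ Finset.range q₁, ∑ n ∈ Finset.range q₁,
    (starRingEnd ℂ) (χ₂ ((r + q₂ * k : ℕ) : ZMod q₂)) * (starRingEnd ℂ) (χ₁ (n : ZMod q₁)) *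
      ((B1 (((r + q₂ * k : ℕ) : ℝ) / (((q₁ * q₂ : ℕ) : ℤ) : ℝ)) *
        B1 ((n : ℝ) / (q₁ : ℝ) + ((((q₁ * q₂ : ℕ) : ℤ) - 1 : ℤ) : ℝ) * ((r + q₂ * k : ℕ) : ℝ)
          / (((q₁ * q₂ : ℕ) : ℤ) : ℝ)) : ℝ) : ℂ))
      = (starRingEnd ℂ) (χ₂ (r : ZMod q₂)) * ∑ k : ZMod q₁, ∑ n : ZMod q₁,
        (starRingEnd ℂ) (χ₁ n) * (((k.val : ℂ) / q₁) * (((n - k - 1).val : ℂ) / q₁)) := by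
    intro r hr
    rw [Finset.mem_range] at hr
    have hc : ∀ k : ℕ, ((r + q₂ * k : ℕ) : ZMod q₂) = r := by intro k; simp
    simp only [hc]
    rcases Nat.eq_zero_or_pos r with rfl | h0
    · haveI : Fact (1 < q₂) := ⟨hq₂⟩
      have : χ₂ ((0 : ℕ) : ZMod q₂) = 0 := by
        rw [Nat.cast_zero]; exact χ₂.map_nonunit not_isUnit_zero
      simp only [this]
      simp
    · rw [← inner_ded_sum (fun n => (starRingEnd ℂ) (χ₁ n)) s1 (fun k => (k.val : ℂ) / q₁)
        ((r : ℂ) / (q₁ * q₂) - 1 / 2) (1 / q₁ - (r : ℂ) / (q₁ * q₂) - 1 / 2)]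
      rw [sum_range_zmod_s14, Finset.mul_sum]
      refine Finset.sum_congr rfl fun k _ => ?_
      rw [sum_range_zmod_s14, Finset.mul_sum]
      refine Finset.sum_congr rfl fun n _ => ?_
      have a1 := B1_key r h0 hr k n
      have a2 := B1_key2 r h0 hr k
      push_cast
      rw [a1, a2, ZMod.natCast_zmod_val]
      push_cast
      ring
  rw [Finset.sum_congr rfl key, ← Finset.sum_mul, sum_range_zmod_s14]
  simp only [ZMod.natCast_zmod_val]
  rw [s2, zero_mul]
end

section
/- Suppose χ₁' and χ₂' are primitive Dirichlet characters modulo q₁ and q₂ respectively with χ₁'(−1)χ₂'(−1) = 1, and suppose there exists a ring homomorphism σ : ℂ → ℂ with χ₁' = σ∘χ₁ and χ₂' = σ∘χ₂ (i.e., S_{χ₁,χ₂} and S_{χ₁',χ₂'} lie in the same Galois orbit). Then S_{χ₁,χ₂} and S_{χ₁',χ₂'} have the same kernel: for all integers a, c with c > 0, q₁q₂ | c, and gcd(a, c) = 1, S_{χ₁,χ₂}(a, c) = 0 if and only if S_{χ₁',χ₂'}(a, c) = 0. -/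
open scoped MatrixGroups
open CongruenceSubgroup Matrix

theorem B1_rat (x : ℚ) : ∃ r : ℚ, B1 (x : ℝ) = (r : ℝ) := by
  unfold B1
  split_ifs
  · exact ⟨0, by simp⟩
  · exact ⟨Int.fract x - 1 / 2, by push_cast; rfl⟩

theorem map_conj_char {q : ℕ} [NeZero q] (χ : DirichletCharacter ℂ q) (σ : ℂ →+* ℂ)
    (x : ZMod q) :
    σ ((starRingEnd ℂ) (χ x)) = (starRingEnd ℂ) ((χ.ringHomComp σ) x) := by
  have key : ∀ ψ : DirichletCharacter ℂ q, (starRingEnd ℂ) (ψ x) = ψ (Ring.inverse x) := by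
    intro ψ
    rw [← MulChar.inv_apply]
    exact MulChar.star_apply' ψ x
  rw [key, key]
  rfl

theorem map_ded {q₁ q₂ : ℕ} [NeZero q₁] [NeZero q₂] (χ₁ : DirichletCharacter ℂ q₁)
    (χ₂ : DirichletCharacter ℂ q₂) (σ : ℂ →+* ℂ) (a c : ℤ) :
    σ (ded χ₁ χ₂ a c) = ded (χ₁.ringHomComp σ) (χ₂.ringHomComp σ) a c := by
  unfold ded
  simp only [map_sum, map_mul, map_conj_char]
  refine Finset.sum_congr rfl fun j _ => Finset.sum_congr rfl fun n _ => ?_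
  congr 1
  obtain ⟨r, hr⟩ := B1_rat ((j : ℚ) / (c : ℚ))
  obtain ⟨s, hs⟩ := B1_rat ((n : ℚ) / (q₁ : ℚ) + (a : ℚ) * (j : ℚ) / (c : ℚ))
  push_cast at hr hs
  rw [hr, hs]
  have : (((r : ℝ) * (s : ℝ) : ℝ) : ℂ) = ((r * s : ℚ) : ℂ) := by push_cast; rfl
  rw [this, map_ratCast]

/-- Dedekind sums in the same Galois orbit have the same kernel. -/
theorem ded_same_orbit_same_kernel {q₁ q₂ : ℕ} (hq₁ : 1 < q₁) (hq₂ : 1 < q₂)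
    (χ₁ : DirichletCharacter ℂ q₁) (χ₂ : DirichletCharacter ℂ q₂)
    (h₁ : χ₁.IsPrimitive) (h₂ : χ₂.IsPrimitive)
    (hpar : χ₁ (-1) * χ₂ (-1) = 1)
    (χ₁' : DirichletCharacter ℂ q₁) (χ₂' : DirichletCharacter ℂ q₂)
    (h₁' : χ₁'.IsPrimitive) (h₂' : χ₂'.IsPrimitive)
    (hpar' : χ₁' (-1) * χ₂' (-1) = 1)
    (σ : ℂ →+* ℂ) (hσ₁ : χ₁' = χ₁.ringHomComp σ) (hσ₂ : χ₂' = χ₂.ringHomComp σ)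
    (a c : ℤ) (hc : 0 < c) (hdvd : ((q₁ * q₂ : ℕ) : ℤ) ∣ c) (hcop : IsCoprime a c) :
    ded χ₁ χ₂ a c = 0 ↔ ded χ₁' χ₂' a c = 0 := by
  haveI : NeZero q₁ := ⟨by omega⟩
  haveI : NeZero q₂ := ⟨by omega⟩
  subst hσ₁ hσ₂
  rw [← map_ded, map_eq_zero]
end
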